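/- There exists a holomorphic function p on the open unit disc 𝔻 with Re p(z) > 0 for all z ∈ 𝔻 such that it is NOT the case that I_p(r) = O((1-r)^{-1}) as r → 1⁻; i.e., limsup_{r→1⁻} (1-r) I_p(r) = +∞. In particular, the answer to Thomas's problem (whether ∫₀^{2π} |z p'(z)/p(z)|² dθ = O(1/(1-r)) for all Carathéodory functions) is negative. -/

import Mathlib

open Filter Set

/-- The integral mean `I_p(r) = ∫₀^{2π} |z p'(z)/p(z)|² dθ`, `z = r e^{iθ}`. -/
noncomputable def Ip (p : ℂ → ℂ) (r : ℝ) : ℝ :=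
  ∫ θ in (0:ℝ)..(2 * Real.pi),
    ‖(↑r * Complex.exp (↑θ * Complex.I)) * deriv p (↑r * Complex.exp (↑θ * Complex.I)) /
      p (↑r * Complex.exp (↑θ * Complex.I))‖ ^ 2

/-- The lacunary series `∑ 2^{-k-1} z^{16^k}`. -/
noncomputable def lacunary (z : ℂ) : ℂ := ∑' k : ℕ, (1 / 2 / 2 ^ k : ℂ) * z ^ (16 ^ k)

lemma norm_lacunary_term_le (k : ℕ) {z : ℂ} (hz : ‖z‖ ≤ 1) :
    ‖(1 / 2 / 2 ^ k : ℂ) * z ^ (16 ^ k)‖ ≤ 1 / 2 / 2 ^ k := by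
  have h : ‖z‖ ^ (16 ^ k) ≤ 1 := pow_le_one₀ (norm_nonneg z) hz
  have hk : (0 : ℝ) ≤ 1 / 2 / 2 ^ k := by positivity
  simpa using mul_le_mul_of_nonneg_left h hk

lemma differentiableOn_lacunary : DifferentiableOn ℂ lacunary (Metric.ball 0 1) := by
  refine Complex.differentiableOn_tsum_of_summable_norm (summable_geometric_two' 1)
    (fun k => by fun_prop) Metric.isOpen_ball fun k w hw => ?_
  exact norm_lacunary_term_le k (mem_ball_zero_iff.1 hw).le

lemma norm_lacunary_le {z : ℂ} (hz : ‖z‖ ≤ 1) : ‖lacunary z‖ ≤ 1 :=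
  tsum_of_norm_bounded (hasSum_geometric_two' 1) fun k => norm_lacunary_term_le k hz

lemma integral_exp_int_mul_I (m : ℤ) :
    ∫ θ in (0 : ℝ)..(2 * Real.pi), Complex.exp (m * Complex.I * θ) =
      if m = 0 then (2 * Real.pi : ℂ) else 0 := by
  split_ifs with h
  · simp [h]
  · rw [integral_exp_mul_complex (by simp [h])]
    have : (m : ℂ) * Complex.I * ((2 * Real.pi : ℝ) : ℂ) = m * (2 * Real.pi * Complex.I) := by
      push_cast; ring
    rw [this, Complex.exp_int_mul_two_pi_mul_I]
    simp

lemma norm_exp_neg_nat_mul_I_mul (n : ℕ) (θ : ℝ) :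
    ‖Complex.exp (-(n : ℂ) * Complex.I * θ)‖ = 1 := by
  rw [← Complex.norm_exp_ofReal_mul_I (-n * θ)]
  congr 2
  push_cast
  ring

lemma integral_lacunary_mul_exp {r : ℝ} (h0 : 0 ≤ r) (h1 : r ≤ 1) (k : ℕ) :
    ∫ θ in (0 : ℝ)..(2 * Real.pi), lacunary (r * Complex.exp (θ * Complex.I)) *
      Complex.exp (-((16 ^ k : ℕ) : ℂ) * Complex.I * θ) =
      2 * Real.pi * (1 / 2 / 2 ^ k * r ^ (16 ^ k)) := by
  let F : ℕ → C(ℝ, ℂ) := fun j =>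
    ⟨fun θ : ℝ => (1 / 2 / 2 ^ j : ℂ) * (r * Complex.exp (θ * Complex.I)) ^ (16 ^ j) *
      Complex.exp (-((16 ^ k : ℕ) : ℂ) * Complex.I * θ), by fun_prop⟩
  have hF : ∀ j (θ : ℝ), F j θ = (1 / 2 / 2 ^ j * r ^ (16 ^ j) : ℂ) *
      Complex.exp (((16 ^ j - 16 ^ k : ℤ) : ℂ) * Complex.I * θ) := by
    intro j θ
    simp only [F, ContinuousMap.coe_mk, mul_pow, ← Complex.exp_nat_mul]
    rw [← mul_assoc, mul_assoc _ (Complex.exp _), ← Complex.exp_add]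
    congr 2
    push_cast
    ring
  have hz : ∀ θ : ℝ, ‖(r : ℂ) * Complex.exp (θ * Complex.I)‖ ≤ 1 := by
    intro θ
    simpa [Complex.norm_exp_ofReal_mul_I, abs_of_nonneg h0] using h1
  have hle : ∀ j θ, ‖F j θ‖ ≤ 1 / 2 / 2 ^ j := by
    intro j θ
    simp only [F, ContinuousMap.coe_mk]
    rw [norm_mul _ (Complex.exp (-_ * _ * _)), norm_exp_neg_nat_mul_I_mul, mul_one]
    exact norm_lacunary_term_le j (hz θ)
  have hs := intervalIntegral.hasSum_intervalIntegral_of_summable_norm (a := 0) (b := 2 * Real.pi) (f := F)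
    ((summable_geometric_two' 1).of_nonneg_of_le (fun _ => norm_nonneg _) fun j =>
      (ContinuousMap.norm_le _ (by positivity)).2 fun θ => hle j θ)
  have hcoef : ∀ j, ∫ θ in (0 : ℝ)..(2 * Real.pi), F j θ =
      if j = k then (2 * Real.pi * (1 / 2 / 2 ^ k * r ^ (16 ^ k)) : ℂ) else 0 := by
    intro j
    simp only [hF]
    rw [intervalIntegral.integral_const_mul, integral_exp_int_mul_I]
    have : ((16 : ℤ) ^ j - 16 ^ k = 0) ↔ j = k := by
      rw [sub_eq_zero]
      exact pow_right_inj₀ (by norm_num) (by norm_num)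
    simp only [this]
    split_ifs with h
    · rw [h]; ring
    · simp
  simp only [hcoef] at hs
  have := hs.unique (hasSum_ite_eq k _)
  rw [← this]
  refine intervalIntegral.integral_congr fun θ _ => ?_
  simp only [lacunary, F, ContinuousMap.coe_mk]
  exact tsum_mul_right.symm

/-- The `n`-th Fourier coefficient of `z f'(z)` on a circle is `n` times that of `f`. -/
lemma integral_mul_deriv_mul_exp {f : ℂ → ℂ} (hf : DifferentiableOn ℂ f (Metric.ball 0 1))
    {r : ℝ} (h0 : 0 ≤ r) (h1 : r < 1) (n : ℕ) :
    ∫ θ in (0 : ℝ)..(2 * Real.pi), (r * Complex.exp (θ * Complex.I)) *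
      deriv f (r * Complex.exp (θ * Complex.I)) * Complex.exp (-(n : ℂ) * Complex.I * θ) =
      n * ∫ θ in (0 : ℝ)..(2 * Real.pi), f (r * Complex.exp (θ * Complex.I)) *
        Complex.exp (-(n : ℂ) * Complex.I * θ) := by
  have hz : ∀ θ : ℝ, (r : ℂ) * Complex.exp (θ * Complex.I) ∈ Metric.ball (0 : ℂ) 1 := by
    intro θ
    simpa [Complex.norm_exp_ofReal_mul_I, abs_of_nonneg h0] using h1
  have hc : Continuous fun θ : ℝ => (r : ℂ) * Complex.exp (θ * Complex.I) := by fun_prop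
  have hfc : Continuous fun θ : ℝ => f (r * Complex.exp (θ * Complex.I)) :=
    hf.continuousOn.comp_continuous hc hz
  have hdc : Continuous fun θ : ℝ => deriv f (r * Complex.exp (θ * Complex.I)) :=
    (hf.deriv Metric.isOpen_ball).continuousOn.comp_continuous hc hz
  have hu : ∀ θ : ℝ, HasDerivAt (fun θ : ℝ => f (r * Complex.exp (θ * Complex.I)))
      (deriv f (r * Complex.exp (θ * Complex.I)) *
        (r * (Complex.exp (θ * Complex.I) * Complex.I))) θ := by
    intro θ
    have hd := (hf.differentiableAt (Metric.isOpen_ball.mem_nhds (hz θ))).hasDerivAt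
    have he : HasDerivAt (fun θ : ℝ => (r : ℂ) * Complex.exp (θ * Complex.I))
        (r * (Complex.exp (θ * Complex.I) * Complex.I)) θ := by
      simpa using (((Complex.ofRealCLM.hasDerivAt (x := θ)).mul_const Complex.I).cexp).const_mul
        (r : ℂ)
    exact hd.comp θ he
  have hv : ∀ θ : ℝ, HasDerivAt (fun θ : ℝ => Complex.exp (-(n : ℂ) * Complex.I * θ))
      (Complex.exp (-(n : ℂ) * Complex.I * θ) * (-(n : ℂ) * Complex.I)) θ := by
    intro θ
    simpa using ((Complex.ofRealCLM.hasDerivAt (x := θ)).const_mul (-(n : ℂ) * Complex.I)).cexp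
  have hparts := intervalIntegral.integral_deriv_mul_eq_sub (a := 0) (b := 2 * Real.pi)
    (fun θ _ => hu θ) (fun θ _ => hv θ)
    (Continuous.intervalIntegrable (by fun_prop) _ _)
    (Continuous.intervalIntegrable (by fun_prop) _ _)
  have hbdry : Complex.exp (-(n : ℂ) * Complex.I * ((2 * Real.pi : ℝ) : ℂ)) = 1 := by
    rw [← Complex.exp_int_mul_two_pi_mul_I (-(n : ℤ))]
    congr 1
    push_cast
    ring
  have hper : Complex.exp (((2 * Real.pi : ℝ) : ℂ) * Complex.I) = 1 := by
    simp
  rw [hbdry, hper] at hparts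
  simp only [Complex.ofReal_zero, zero_mul, mul_zero, Complex.exp_zero, sub_self] at hparts
  have hrhs : Continuous fun θ : ℝ => (n : ℂ) * (f (r * Complex.exp (θ * Complex.I)) *
      Complex.exp (-(n : ℂ) * Complex.I * θ)) :=
    continuous_const.mul (hfc.mul (by fun_prop))
  rw [← intervalIntegral.integral_const_mul, ← sub_eq_zero,
    ← intervalIntegral.integral_sub (Continuous.intervalIntegrable (by fun_prop) _ _)
      (hrhs.intervalIntegrable _ _)]
  apply mul_left_cancel₀ Complex.I_ne_zero
  rw [mul_zero, ← hparts, ← intervalIntegral.integral_const_mul]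
  refine intervalIntegral.integral_congr fun θ _ => ?_
  ring

/-- A quadratic lower bound equivalent to the Cauchy-Schwarz inequality. -/
lemma integral_norm_sq_ge {g : ℝ → ℂ} (hg : Continuous g) {t : ℝ} (ht : 0 ≤ t)
    (h : 2 * Real.pi * t ≤ ‖∫ θ in (0 : ℝ)..(2 * Real.pi), g θ‖) :
    2 * Real.pi * t ^ 2 ≤ ∫ θ in (0 : ℝ)..(2 * Real.pi), ‖g θ‖ ^ 2 := by
  have hpi : (0 : ℝ) ≤ 2 * Real.pi := by positivity
  have h1 : ∫ θ in (0 : ℝ)..(2 * Real.pi), (2 * t * ‖g θ‖ - t ^ 2) ≤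
      ∫ θ in (0 : ℝ)..(2 * Real.pi), ‖g θ‖ ^ 2 := by
    refine intervalIntegral.integral_mono_on hpi
      (Continuous.intervalIntegrable (by fun_prop) _ _)
      (Continuous.intervalIntegrable (by fun_prop) _ _) fun θ _ => ?_
    nlinarith [sq_nonneg (‖g θ‖ - t)]
  rw [intervalIntegral.integral_sub (Continuous.intervalIntegrable (by fun_prop) _ _)
    (Continuous.intervalIntegrable (by fun_prop) _ _),
    intervalIntegral.integral_const_mul, intervalIntegral.integral_const, smul_eq_mul] at h1
  have h2 := intervalIntegral.norm_integral_le_integral_norm (f := g) hpi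
    (μ := MeasureTheory.volume)
  nlinarith [mul_le_mul_of_nonneg_left (h.trans h2) ht]

lemma Ip_exp_lacunary_ge {r : ℝ} (h0 : 0 ≤ r) (h1 : r < 1) (k : ℕ) :
    2 * Real.pi * (16 ^ k * (1 / 2 / 2 ^ k * r ^ (16 ^ k))) ^ 2 ≤
      Ip (fun z => Complex.exp (lacunary z)) r := by
  have hz : ∀ θ : ℝ, (r : ℂ) * Complex.exp (θ * Complex.I) ∈ Metric.ball (0 : ℂ) 1 := by
    intro θ
    simpa [Complex.norm_exp_ofReal_mul_I, abs_of_nonneg h0] using h1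
  have hc : Continuous fun θ : ℝ => (r : ℂ) * Complex.exp (θ * Complex.I) := by fun_prop
  have hdc : Continuous fun θ : ℝ => deriv lacunary (r * Complex.exp (θ * Complex.I)) :=
    (differentiableOn_lacunary.deriv Metric.isOpen_ball).continuousOn.comp_continuous hc hz
  have hI : Ip (fun z => Complex.exp (lacunary z)) r =
      ∫ θ in (0 : ℝ)..(2 * Real.pi), ‖(r * Complex.exp (θ * Complex.I)) *
        deriv lacunary (r * Complex.exp (θ * Complex.I)) *
          Complex.exp (-((16 ^ k : ℕ) : ℂ) * Complex.I * θ)‖ ^ 2 := by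
    refine intervalIntegral.integral_congr fun θ _ => ?_
    have hd := differentiableOn_lacunary.differentiableAt (Metric.isOpen_ball.mem_nhds (hz θ))
    beta_reduce
    rw [hd.hasDerivAt.cexp.deriv, norm_mul _ (Complex.exp (-_ * _ * _)), norm_exp_neg_nat_mul_I_mul, mul_one]
    congr 2
    field_simp [Complex.exp_ne_zero]
  rw [hI]
  refine integral_norm_sq_ge (by fun_prop) (by positivity) ?_
  rw [integral_mul_deriv_mul_exp differentiableOn_lacunary h0 h1,
    integral_lacunary_mul_exp h0 h1.le]
  apply le_of_eq
  simp [abs_of_nonneg h0, abs_of_nonneg Real.pi_pos.le]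
  ring

lemma four_pow_le_mul_Ip (k : ℕ) :
    Real.pi / 16 * 4 ^ k ≤ (1 - (1 - 1 / (2 * 16 ^ k))) *
      Ip (fun z => Complex.exp (lacunary z)) (1 - 1 / (2 * 16 ^ k)) := by
  have hn : (1 : ℝ) ≤ 16 ^ k := one_le_pow₀ (by norm_num)
  have hle : (1 : ℝ) / (2 * 16 ^ k) ≤ 1 / 2 := by
    rw [div_le_div_iff₀ (by positivity) (by norm_num)]; linarith
  have hpos : (0 : ℝ) < 1 / (2 * 16 ^ k) := by positivity
  have hI := Ip_exp_lacunary_ge (r := 1 - 1 / (2 * 16 ^ k)) (by linarith) (by linarith) k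
  have hb : (1 / 2 : ℝ) ≤ (1 - 1 / (2 * 16 ^ k)) ^ (16 ^ k) := by
    have := one_add_mul_le_pow (a := -(1 / (2 * 16 ^ k) : ℝ)) (by linarith) (16 ^ k)
    rw [← sub_eq_add_neg] at this
    refine le_trans (le_of_eq ?_) this
    push_cast
    field_simp
    norm_num
  rw [sub_sub_cancel]
  calc Real.pi / 16 * 4 ^ k
      = 1 / (2 * 16 ^ k) * (2 * Real.pi * (16 ^ k * (1 / 2 / 2 ^ k * (1 / 2))) ^ 2) := by
        have h16 : (16 : ℝ) ^ k = (2 ^ k) ^ 4 := by rw [← pow_mul, mul_comm, pow_mul]; norm_num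
        have h4 : (4 : ℝ) ^ k = (2 ^ k) ^ 2 := by rw [← pow_mul, mul_comm, pow_mul]; norm_num
        rw [h16, h4]
        field_simp
        norm_num
    _ ≤ 1 / (2 * 16 ^ k) *
          (2 * Real.pi * (16 ^ k * (1 / 2 / 2 ^ k * (1 - 1 / (2 * 16 ^ k)) ^ (16 ^ k))) ^ 2) := by
        gcongr
    _ ≤ _ := by gcongr

/-- Negative answer to Thomas's problem: there is a Carathéodory function `p`
with `limsup_{r→1⁻} (1-r) I_p(r) = +∞`, so `I_p(r) ≠ O((1-r)^{-1})`. -/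
theorem stmt17 :
    ∃ p : ℂ → ℂ, DifferentiableOn ℂ p (Metric.ball (0:ℂ) 1) ∧
      (∀ z ∈ Metric.ball (0:ℂ) 1, 0 < (p z).re) ∧
      ∀ M : ℝ, ∃ᶠ r in nhdsWithin (1:ℝ) (Set.Iio 1), M < (1 - r) * Ip p r := by
  refine ⟨fun z => Complex.exp (lacunary z), differentiableOn_lacunary.cexp, fun z hz => ?_,
    fun M => ?_⟩
  · have h := (Complex.abs_im_le_norm _).trans (norm_lacunary_le (mem_ball_zero_iff.1 hz).le)
    rw [abs_le] at h
    rw [Complex.exp_re]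
    have := Real.pi_gt_three
    exact mul_pos (Real.exp_pos _) (Real.cos_pos_of_mem_Ioo ⟨by linarith, by linarith⟩)
  · have hr : Tendsto (fun k : ℕ => 1 - 1 / (2 * 16 ^ k) : ℕ → ℝ) atTop
        (nhdsWithin 1 (Set.Iio 1)) := by
      refine tendsto_nhdsWithin_iff.2 ⟨?_, Eventually.of_forall fun k => ?_⟩
      · have := (tendsto_pow_atTop_nhds_zero_of_lt_one (r := (1 / 16 : ℝ)) (by norm_num)
          (by norm_num)).const_mul (1 / 2 : ℝ)
        refine (this.const_sub 1).congr' (Eventually.of_forall fun k => ?_) |>.trans (by simp)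
        simp [mul_comm]
      · have : (0 : ℝ) < 1 / (2 * 16 ^ k) := by positivity
        exact sub_lt_self 1 this
    refine hr.frequently (Eventually.frequently ?_)
    have hg : Tendsto (fun k : ℕ => Real.pi / 16 * 4 ^ k) atTop atTop :=
      (tendsto_pow_atTop_atTop_of_one_lt (by norm_num)).const_mul_atTop (by positivity)
    filter_upwards [hg.eventually_gt_atTop M] with k hk
    exact hk.trans_le (four_pow_le_mul_Ip k)
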